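/- Let (Ω, 𝒜, λ) be a probability space, let (μ^⟦n⟧)_{n≥0} be a cubic coupling on it, and let d ≥ 1. Let S = {0,1}^d and K_d = S ∖ {0^d}. Then 𝒜^S_{{0^d}} and 𝒜^S_{K_d} are conditionally independent relative to 𝒜^S_{{0^d}} ∧_{μ^⟦d⟧} 𝒜^S_{K_d}. -/

import Mathlib

open MeasureTheory Set

/-- The meet `ℬ₀ ∧_μ ℬ₁` of two sub-σ-algebras relative to a measure `μ`:
the σ-algebra of all (ambient-)measurable sets `s` admitting `b₀ ∈ ℬ₀` and `b₁ ∈ ℬ₁`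
with `μ (s ∆ b₀) = μ (s ∆ b₁) = 0`. -/
def meetAlg {α : Type*} {mα : MeasurableSpace α} (μ : Measure α)
    (B0 B1 : MeasurableSpace α) : MeasurableSpace α where
  MeasurableSet' s := MeasurableSet[mα] s ∧
    (∃ b0, MeasurableSet[B0] b0 ∧ μ (symmDiff s b0) = 0) ∧
    (∃ b1, MeasurableSet[B1] b1 ∧ μ (symmDiff s b1) = 0)
  measurableSet_empty :=
    ⟨@MeasurableSet.empty _ mα, ⟨∅, @MeasurableSet.empty _ B0, by simp⟩,
      ⟨∅, @MeasurableSet.empty _ B1, by simp⟩⟩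
  measurableSet_compl := by
    rintro s ⟨hs, ⟨b0, hb0, h0⟩, ⟨b1, hb1, h1⟩⟩
    exact ⟨hs.compl, ⟨b0ᶜ, hb0.compl, by rwa [compl_symmDiff_compl]⟩,
      ⟨b1ᶜ, hb1.compl, by rwa [compl_symmDiff_compl]⟩⟩
  measurableSet_iUnion := by
    intro f hf
    have key : ∀ (s b : ℕ → Set α),
        symmDiff (⋃ i, s i) (⋃ i, b i) ⊆ ⋃ i, symmDiff (s i) (b i) := by
      intro s b x hx
      rw [Set.mem_symmDiff] at hx
      rcases hx with ⟨hx1, hx2⟩ | ⟨hx1, hx2⟩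
      · obtain ⟨i, hi⟩ := Set.mem_iUnion.1 hx1
        exact Set.mem_iUnion.2 ⟨i, Set.mem_symmDiff.2
          (Or.inl ⟨hi, fun h => hx2 (Set.mem_iUnion.2 ⟨i, h⟩)⟩)⟩
      · obtain ⟨i, hi⟩ := Set.mem_iUnion.1 hx1
        exact Set.mem_iUnion.2 ⟨i, Set.mem_symmDiff.2
          (Or.inr ⟨hi, fun h => hx2 (Set.mem_iUnion.2 ⟨i, h⟩)⟩)⟩
    choose hmeas h0 h1 using hf
    choose b0 hb0 hb0' using h0
    choose b1 hb1 hb1' using h1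
    exact ⟨MeasurableSet.iUnion hmeas,
      ⟨⋃ i, b0 i, MeasurableSet.iUnion hb0,
        measure_mono_null (key f b0) (measure_iUnion_null hb0')⟩,
      ⟨⋃ i, b1 i, MeasurableSet.iUnion hb1,
        measure_mono_null (key f b1) (measure_iUnion_null hb1')⟩⟩

/-- Conditional independence of the sub-σ-algebras `B0` and `B1` relative to `B`,
with respect to the measure `μ`: `E(f₀ f₁ | B) = E(f₀ | B) ⬝ E(f₁ | B)` a.e. for all
bounded `B0`- resp. `B1`-measurable real functions. -/
def CondIndepRel {α : Type*} {mα : MeasurableSpace α} (μ : Measure α)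
    (B0 B1 B : MeasurableSpace α) : Prop :=
  ∀ f0 f1 : α → ℝ, Measurable[B0] f0 → Measurable[B1] f1 →
    (∃ C, ∀ x, |f0 x| ≤ C) → (∃ C, ∀ x, |f1 x| ≤ C) →
    μ[fun x => f0 x * f1 x|B] =ᵐ[μ] fun x => (μ[f0|B]) x * (μ[f1|B]) x

/-- Two σ-algebras agree up to `μ`-null sets: every set of either one differs from a set
of the other by a `μ`-null set. -/
def EqModNull {α : Type*} {mα : MeasurableSpace α} (μ : Measure α)
    (B0 B1 : MeasurableSpace α) : Prop :=
  (∀ s, MeasurableSet[B0] s → ∃ t, MeasurableSet[B1] t ∧ μ (symmDiff s t) = 0) ∧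
  (∀ s, MeasurableSet[B1] s → ∃ t, MeasurableSet[B0] t ∧ μ (symmDiff s t) = 0)

/-- The sub-σ-algebra `𝒜^S_T` of the product σ-algebra on `ι → Ω`:
preimages under the projection to coordinates in `T` of product-measurable sets. -/
def cylinderAlg {Ω : Type*} (ι : Type*) [MeasurableSpace Ω] (T : Set ι) :
    MeasurableSpace (ι → Ω) :=
  MeasurableSpace.comap (fun ω => T.restrict ω) MeasurableSpace.pi

/-- The relation `T₁ ⊥_μ T₂` for index sets of a self-coupling: the coordinate
σ-algebras `𝒜^S_{T₁}` and `𝒜^S_{T₂}` are conditionally independent relative to their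
meet, and moreover this meet agrees with `𝒜^S_{T₁ ∩ T₂}` up to `μ`-null sets. -/
def BotRel {Ω ι : Type*} [MeasurableSpace Ω] (μ : Measure (ι → Ω)) (T1 T2 : Set ι) : Prop :=
  CondIndepRel μ (cylinderAlg ι T1) (cylinderAlg ι T2)
      (meetAlg μ (cylinderAlg ι T1) (cylinderAlg ι T2)) ∧
  EqModNull μ (meetAlg μ (cylinderAlg ι T1) (cylinderAlg ι T2)) (cylinderAlg ι (T1 ∩ T2))

/-- A cube morphism `{0,1}^m → {0,1}^n`: each coordinate function is constant, a
coordinate of the argument, or the negation of a coordinate of the argument (i.e. the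
map extends to an affine homomorphism `ℤ^m → ℤ^n`). -/
def IsCubeMorphism {m n : ℕ} (φ : (Fin m → Bool) → (Fin n → Bool)) : Prop :=
  ∀ j : Fin n, (∃ c, ∀ v, φ v j = c) ∨
    ∃ i : Fin m, (∀ v, φ v j = v i) ∨ (∀ v, φ v j = !(v i))

/-- A cubic coupling on a probability space `(Ω, 𝒜, lam)`: a sequence of self-couplings
`μ n` of `lam` indexed by the discrete cubes `{0,1}^n`, satisfying the consistency,
ergodicity and conditional independence axioms. -/
structure IsCubicCoupling {Ω : Type*} [MeasurableSpace Ω] (lam : Measure Ω)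
    (μ : (n : ℕ) → Measure ((Fin n → Bool) → Ω)) : Prop where
  coupling : ∀ (n : ℕ) (v : Fin n → Bool), (μ n).map (fun ω => ω v) = lam
  consistency : ∀ {m n : ℕ} (φ : (Fin m → Bool) → (Fin n → Bool)),
    IsCubeMorphism φ → Function.Injective φ →
    (μ n).map (fun ω => ω ∘ φ) = μ m
  ergodicity : μ 1 = Measure.pi fun _ : Fin 1 → Bool => lam
  condIndep : ∀ n : ℕ,
    BotRel (μ (n + 1)) {v : Fin (n + 1) → Bool | v 0 = false}
      {v : Fin (n + 1) → Bool | v (Fin.last n) = false}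

/-- A set `H ⊆ {0,1}^m` is simplicial if it is downward closed with respect to the
coordinatewise order (support inclusion). -/
def IsSimplicial {m : ℕ} (H : Set (Fin m → Bool)) : Prop :=
  ∀ v ∈ H, ∀ w : Fin m → Bool, (∀ i, w i = true → v i = true) → w ∈ H

namespace CubicAux

open Filter Topology

variable {α : Type*}

theorem aem_limit {k : MeasurableSpace α} {m0 : MeasurableSpace α} {ν : Measure α} {g : ℕ → α → ℝ} {f : α → ℝ}
    (hg : ∀ n, AEStronglyMeasurable[k] (g n) ν)
    (hlim : ∀ᵐ x ∂ν, Tendsto (fun n => g n x) atTop (𝓝 (f x))) :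
    AEStronglyMeasurable[k] f ν := by
  choose g' hg' hgg using hg
  refine ⟨fun x => limsup (fun n => g' n x) atTop, ?_, ?_⟩
  · exact (Measurable.limsup (fun n => (hg' n).measurable)).stronglyMeasurable
  · filter_upwards [hlim, ae_all_iff.2 hgg] with x hx hx'
    simp only [hx'] at hx
    exact hx.limsup_eq.symm

theorem aem_transfer {B k : MeasurableSpace α} {m0 : MeasurableSpace α} {ν : Measure α} {f : α → ℝ}
    (hBk : ∀ s, MeasurableSet[B] s → ∃ t, MeasurableSet[k] t ∧ ν (symmDiff s t) = 0)
    (hf : StronglyMeasurable[B] f) : AEStronglyMeasurable[k] f ν := by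
  refine aem_limit (g := fun n => hf.approx n) ?_ (ae_of_all _ fun x => hf.tendsto_approx x)
  intro n
  generalize hf.approx n = φ
  induction φ using SimpleFunc.induction with
  | @const c s hs =>
    obtain ⟨t, ht, hst⟩ := hBk s hs
    refine ⟨t.indicator fun _ => c, ?_, ?_⟩
    · exact stronglyMeasurable_const.indicator ht
    · have h1 : s =ᵐ[ν] t := measure_symmDiff_eq_zero_iff.1 hst
      have h2 := indicator_ae_eq_of_ae_eq_set (f := fun _ : α => c) h1
      refine EventuallyEq.trans (Eventually.of_forall fun x => ?_) h2
      simp [SimpleFunc.coe_piecewise, Set.piecewise_eq_indicator]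
      rfl
  | @add f g _ hf hg => exact hf.add hg

/-- tower property for inclusion modulo null sets -/
theorem tower_modNull {B k : MeasurableSpace α} {m0 : MeasurableSpace α} {ν : Measure α} [IsProbabilityMeasure ν]
    {f : α → ℝ} (hB : B ≤ m0) (hk : k ≤ m0)
    (hBk : ∀ s, MeasurableSet[B] s → ∃ t, MeasurableSet[k] t ∧ ν (symmDiff s t) = 0)
    (hf : Integrable f ν) : ν[ν[f|k]|B] =ᵐ[ν] ν[f|B] := by
  refine ae_eq_condExp_of_forall_setIntegral_eq hB hf
    (fun _ _ _ => integrable_condExp.integrableOn) ?_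
    stronglyMeasurable_condExp.aestronglyMeasurable
  intro s hs _
  rw [setIntegral_condExp hB integrable_condExp hs]
  obtain ⟨t, ht, hst⟩ := hBk s hs
  have h1 : s =ᵐ[ν] t := measure_symmDiff_eq_zero_iff.1 hst
  rw [setIntegral_congr_set h1, setIntegral_congr_set h1, setIntegral_condExp hk hf ht]

theorem meetAlg_le {m0 : MeasurableSpace α} (ν : Measure α) (B0 B1 : MeasurableSpace α) : meetAlg ν B0 B1 ≤ m0 :=
  fun _ hs => hs.1

theorem bdd_integrable {m0 : MeasurableSpace α} {ν : Measure α} [IsProbabilityMeasure ν] {f : α → ℝ}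
    (hf : Measurable f) (hb : ∃ C, ∀ x, |f x| ≤ C) : Integrable f ν := by
  obtain ⟨C, hC⟩ := hb
  exact Integrable.of_bound hf.aestronglyMeasurable C (ae_of_all _ hC)

/-- Conditional independence gives `E(f|m2) = E(f|k)`, `k` the meet up to null sets. -/
theorem comm_of_condIndep {m1 m2 k : MeasurableSpace α} {m0 : MeasurableSpace α} {ν : Measure α}
    [IsProbabilityMeasure ν] (h1 : m1 ≤ m0) (h2 : m2 ≤ m0) (hk2 : k ≤ m2)
    (hci : CondIndepRel ν m1 m2 (meetAlg ν m1 m2))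
    (heq : EqModNull ν (meetAlg ν m1 m2) k)
    {f : α → ℝ} (hf : Measurable[m1] f) (hb : ∃ C, ∀ x, |f x| ≤ C) :
    ν[f|m2] =ᵐ[ν] ν[f|k] := by
  set B := meetAlg ν m1 m2 with hBdef
  have hB : B ≤ m0 := meetAlg_le ν m1 m2
  have hk : k ≤ m0 := hk2.trans h2
  have hfi : Integrable f ν := bdd_integrable (hf.mono h1 le_rfl) hb
  have e1 : ν[f|k] =ᵐ[ν] ν[f|B] := by
    refine (tower_modNull hk hB heq.2 hfi).symm.trans ?_
    exact condExp_of_aestronglyMeasurable' hk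
      (aem_transfer heq.1 stronglyMeasurable_condExp) integrable_condExp
  symm
  refine ae_eq_condExp_of_forall_setIntegral_eq h2 hfi
    (fun _ _ _ => integrable_condExp.integrableOn) ?_
    (stronglyMeasurable_condExp.mono hk2).aestronglyMeasurable
  intro s hs _
  have hs0 := h2 s hs
  rw [setIntegral_congr_ae hs0 (e1.mono fun x hx _ => hx)]
  have hone : Measurable[m2] (s.indicator fun _ => (1:ℝ)) := measurable_const.indicator hs
  have hci' := hci f (s.indicator fun _ => (1:ℝ)) hf hone hb
    ⟨1, fun x => by by_cases h : x ∈ s <;> simp [h]⟩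
  have hprod : ∀ g : α → ℝ, (fun x => g x * s.indicator (fun _ => (1:ℝ)) x) = s.indicator g := by
    intro g; ext x; by_cases h : x ∈ s <;> simp [h]
  have hint1 : Integrable (s.indicator fun _ => (1:ℝ)) ν :=
    (integrable_const (1:ℝ)).indicator hs0
  have hpull : ν[ν[f|B] * s.indicator (fun _ => (1:ℝ))|B] =ᵐ[ν]
      ν[f|B] * ν[s.indicator (fun _ => (1:ℝ))|B] := by
    refine condExp_mul_of_aestronglyMeasurable_left
      stronglyMeasurable_condExp.aestronglyMeasurable ?_ hint1
    have := hprod (ν[f|B])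
    change Integrable (fun x => (ν[f|B]) x * s.indicator (fun _ => (1:ℝ)) x) ν
    rw [this]
    exact integrable_condExp.indicator hs0
  rw [← integral_indicator hs0, ← integral_indicator hs0, ← hprod, ← hprod f,
    ← integral_condExp hB, ← integral_condExp hB (f := fun x => f x * _)]
  refine integral_congr_ae ?_
  exact hpull.trans hci'.symm

theorem condIndep_of_aem {m1 m2 : MeasurableSpace α} {m0 : MeasurableSpace α} {ν : Measure α}
    [IsProbabilityMeasure ν] (h1 : m1 ≤ m0) (h2 : m2 ≤ m0)
    (H : ∀ h : α → ℝ, Measurable[m2] h → (∃ C, ∀ x, |h x| ≤ C) →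
      AEStronglyMeasurable[m2] (ν[h|m1]) ν) :
    CondIndepRel ν m1 m2 (meetAlg ν m1 m2) := by
  intro f0 f1 hf0 hf1 hb0 hb1
  set B := meetAlg ν m1 m2 with hBdef
  have hB : B ≤ m0 := meetAlg_le ν m1 m2
  have hB1 : ∀ s, MeasurableSet[B] s → ∃ t, MeasurableSet[m1] t ∧ ν (symmDiff s t) = 0 :=
    fun s hs => hs.2.1
  set u := ν[f1|m1] with hu
  have hum : StronglyMeasurable[m1] u := stronglyMeasurable_condExp
  have huB : Measurable[B] u := by
    obtain ⟨w, hw, huw⟩ := H f1 hf1 hb1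
    intro S hS
    refine ⟨h1 _ (hum.measurable hS), ⟨u ⁻¹' S, hum.measurable hS, by simp⟩,
      ⟨w ⁻¹' S, hw.measurable hS, ?_⟩⟩
    refine measure_symmDiff_eq_zero_iff.2 ?_
    filter_upwards [huw] with x hx
    change (u x ∈ S) = (w x ∈ S)
    rw [hu, hx]
  have i1 : Integrable f1 ν := bdd_integrable (hf1.mono h2 le_rfl) hb1
  have i0 : Integrable f0 ν := bdd_integrable (hf0.mono h1 le_rfl) hb0
  have i01 : Integrable (f0 * f1) ν := by
    obtain ⟨C, hC⟩ := hb0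
    exact i1.bdd_mul (hf0.mono h1 le_rfl).aestronglyMeasurable (ae_of_all _ hC)
  have i0u : Integrable (f0 * u) ν := by
    obtain ⟨C, hC⟩ := hb0
    exact (integrable_condExp (f := f1)).bdd_mul
      (hf0.mono h1 le_rfl).aestronglyMeasurable (ae_of_all _ hC)
  have a1 : ν[f1|B] =ᵐ[ν] u := by
    refine (tower_modNull hB h1 hB1 i1).symm.trans ?_
    rw [condExp_of_stronglyMeasurable hB huB.stronglyMeasurable integrable_condExp]
  have a2 : ν[f0 * f1|m1] =ᵐ[ν] f0 * u :=
    condExp_mul_of_aestronglyMeasurable_left hf0.stronglyMeasurable.aestronglyMeasurable i01 i1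
  have a3 : ν[f0 * f1|B] =ᵐ[ν] ν[f0|B] * u := by
    refine (tower_modNull hB h1 hB1 i01).symm.trans ((condExp_congr_ae a2).trans ?_)
    exact condExp_mul_of_aestronglyMeasurable_right huB.stronglyMeasurable.aestronglyMeasurable
      i0u i0
  refine a3.trans ?_
  filter_upwards [a1] with x hx
  rw [Pi.mul_apply, hx]

theorem condExp_map_comap {β : Type*} {m : MeasurableSpace β} {mβ : MeasurableSpace β} {m0 : MeasurableSpace α} {ν : Measure α}
    [IsProbabilityMeasure ν] {π : α → β} (hπ : Measurable π)
    (hm : m ≤ mβ) {h : β → ℝ} (hh : Measurable h) (hb : ∃ C, ∀ x, |h x| ≤ C) :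
    ((ν.map π)[h|m]) ∘ π =ᵐ[ν] ν[h ∘ π | m.comap π] := by
  have : IsProbabilityMeasure (ν.map π) := Measure.isProbabilityMeasure_map hπ.aemeasurable
  have hle : m.comap π ≤ m0 := (MeasurableSpace.comap_mono hm).trans hπ.comap_le
  have hi : Integrable h (ν.map π) := bdd_integrable hh hb
  have hsm : StronglyMeasurable[m] ((ν.map π)[h|m]) := stronglyMeasurable_condExp
  have hi2 : Integrable ((ν.map π)[h|m]) (ν.map π) := integrable_condExp
  refine ae_eq_condExp_of_forall_setIntegral_eq hle (hi.comp_measurable hπ)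
    (fun _ _ _ => (hi2.comp_measurable hπ).integrableOn) ?_ ?_
  · rintro s ⟨t, ht, rfl⟩ _
    have e : ∀ g : β → ℝ, AEStronglyMeasurable g (ν.map π) →
        ∫ x in π ⁻¹' t, (g ∘ π) x ∂ν = ∫ y in t, g y ∂(ν.map π) := fun g hg =>
      (setIntegral_map (hm t ht) hg hπ.aemeasurable).symm
    rw [e _ hi2.1, e _ hi.1, setIntegral_condExp hm hi ht]
  · exact (hsm.comp_measurable (comap_measurable π)).aestronglyMeasurable

theorem condExp_aem_limit {m k : MeasurableSpace α} {m0 : MeasurableSpace α} {ν : Measure α} [IsProbabilityMeasure ν]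
    (hm : m ≤ m0) {g : ℕ → α → ℝ} {f : α → ℝ} (hg : ∀ n, Measurable (g n)) {C : ℝ}
    (hC : ∀ n x, |g n x| ≤ C) (hlim : ∀ x, Tendsto (fun n => g n x) atTop (𝓝 (f x)))
    (hk : ∀ n, AEStronglyMeasurable[k] (ν[g n|m]) ν) : AEStronglyMeasurable[k] (ν[f|m]) ν := by
  have h1 := tendsto_condExpL1_of_dominated_convergence (μ := ν) hm (fs := g) (f := f) (fun _ => C)
    (fun n => (hg n).aestronglyMeasurable) (integrable_const C)
    (fun n => ae_of_all _ (hC n)) (ae_of_all _ hlim)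
  obtain ⟨ns, _, hns⟩ := (tendstoInMeasure_of_tendsto_Lp h1).exists_seq_tendsto_ae
  refine AEStronglyMeasurable.congr (aem_limit (g := fun i => ν[g (ns i)|m]) (fun i => hk _) ?_)
    (condExp_ae_eq_condExpL1 hm f).symm
  have h2 : ∀ᵐ x ∂ν, ∀ i, (ν[g (ns i)|m]) x = condExpL1 hm ν (g (ns i)) x :=
    ae_all_iff.2 fun i => condExp_ae_eq_condExpL1 hm _
  filter_upwards [hns, h2] with x hx hx2
  simpa only [hx2] using hx

/-- a conditional expectation preserves `k`-measurability if it does so on indicators of a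
generating `π`-system. -/
theorem condExp_aem_of_pi {m k : MeasurableSpace α} {m0 : MeasurableSpace α} {ν : Measure α} [IsProbabilityMeasure ν]
    (hm : m ≤ m0) (hk : k ≤ m0) {S : Set (Set α)} (hS : k = MeasurableSpace.generateFrom S)
    (hpi : IsPiSystem S)
    (H : ∀ s ∈ S, AEStronglyMeasurable[k] (ν[s.indicator fun _ => (1:ℝ)|m]) ν)
    {h : α → ℝ} (hh : Measurable[k] h) (hb : ∃ C, ∀ x, |h x| ≤ C) :
    AEStronglyMeasurable[k] (ν[h|m]) ν := by
  have hind : ∀ s, MeasurableSet[m0] s → Integrable (s.indicator fun _ => (1:ℝ)) ν :=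
    fun s hs => (integrable_const (1:ℝ)).indicator hs
  have hset : ∀ s, MeasurableSet[k] s →
      AEStronglyMeasurable[k] (ν[s.indicator fun _ => (1:ℝ)|m]) ν := by
    intro s hs
    induction s, hs using MeasurableSpace.induction_on_inter hS hpi with
    | empty => simp only [Set.indicator_empty]
               rw [show (fun _ : α => (0:ℝ)) = 0 from rfl, condExp_zero]
               exact stronglyMeasurable_zero.aestronglyMeasurable
    | basic s hs => exact H s hs
    | compl s hs ih =>
      have e : (sᶜ.indicator fun _ => (1:ℝ)) = (fun _ => (1:ℝ)) - s.indicator fun _ => (1:ℝ) := by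
        ext x; by_cases h : x ∈ s <;> simp [h]
      rw [e]
      refine AEStronglyMeasurable.congr ?_ (condExp_sub (integrable_const _) (hind s (hk s hs)) m).symm
      rw [condExp_const hm]
      exact stronglyMeasurable_const.aestronglyMeasurable.sub ih
    | iUnion f hd hf ih =>
      have hfm : ∀ i, MeasurableSet[m0] (f i) := fun i => hk _ (hf i)
      refine condExp_aem_limit (g := fun n => (⋃ i ∈ Finset.range n, f i).indicator fun _ => (1:ℝ))
        (C := 1) hm ?_ ?_ ?_ ?_
      · intro n
        exact measurable_const.indicator (Finset.measurableSet_biUnion _ fun i _ => hfm i)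
      · intro n x
        by_cases h : x ∈ (⋃ i ∈ Finset.range n, f i)
        · simp only [Set.indicator_of_mem h]; norm_num
        · simp only [Set.indicator_of_notMem h]; norm_num
      · intro x
        refine tendsto_const_nhds.congr' ?_
        by_cases h : x ∈ ⋃ i, f i
        · obtain ⟨i, hi⟩ := Set.mem_iUnion.1 h
          filter_upwards [eventually_gt_atTop i] with n hn
          rw [Set.indicator_of_mem h, Set.indicator_of_mem]
          exact Set.mem_biUnion (Finset.mem_coe.2 (Finset.mem_range.2 hn)) hi
        · refine Eventually.of_forall fun n => ?_
          change (⋃ i, f i).indicator (fun _ => (1:ℝ)) x = (⋃ i ∈ Finset.range n, f i).indicator (fun _ => (1:ℝ)) x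
          rw [Set.indicator_of_notMem h, Set.indicator_of_notMem]
          intro h'
          simp only [Set.mem_iUnion] at h'
          obtain ⟨i, _, hi⟩ := h'
          exact h (Set.mem_iUnion.2 ⟨i, hi⟩)
      · intro n
        have e : ((⋃ i ∈ Finset.range n, f i).indicator fun _ => (1:ℝ)) =
            ∑ i ∈ Finset.range n, (f i).indicator fun _ => (1:ℝ) := by
          ext x
          rw [Finset.indicator_biUnion_apply, Finset.sum_apply]
          exact fun i _ j _ hij => hd hij
        rw [e]
        refine AEStronglyMeasurable.congr ?_ (condExp_finsetSum (fun i _ => hind _ (hfm i)) m).symm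
        exact Finset.sum_induction _ (fun f => AEStronglyMeasurable[k] f ν)
          (fun _ _ hf hg => hf.add hg) stronglyMeasurable_zero.aestronglyMeasurable fun i _ => ih i
  obtain ⟨C, hC⟩ := hb
  have hsm : StronglyMeasurable[k] h := hh.stronglyMeasurable
  refine condExp_aem_limit (g := fun n => hsm.approxBounded C n) (C := |C|) hm ?_ ?_ ?_ ?_
  · intro n
    exact (@SimpleFunc.measurable α ℝ k _ (hsm.approxBounded C n)).mono hk le_rfl
  · intro n x
    by_cases hα : 0 ≤ C
    · exact (hsm.norm_approxBounded_le hα n x).trans (le_abs_self C)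
    · exact absurd ((abs_nonneg _).trans (hC x)) hα
  · intro x
    exact hsm.tendsto_approxBounded_of_norm_le (hC x)
  · intro n
    generalize hsm.approxBounded C n = φ
    induction φ using SimpleFunc.induction with
    | @const c s hs =>
      have e : (⇑(@SimpleFunc.piecewise α ℝ k s hs (@SimpleFunc.const α ℝ k c)
          (@SimpleFunc.const α ℝ k 0)) : α → ℝ) = c • s.indicator fun _ => (1:ℝ) := by
        ext x; by_cases h : x ∈ s <;> simp [@SimpleFunc.coe_piecewise α ℝ k, h]
      rw [e]
      refine AEStronglyMeasurable.congr ?_ (condExp_smul c _ m).symm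
      exact (hset s hs).const_smul c
    | @add f g _ hf hg =>
      have hi : ∀ f : @SimpleFunc α k ℝ, Integrable (@DFunLike.coe (@SimpleFunc α k ℝ) α _ (@SimpleFunc.instFunLike α ℝ k) f) ν := by
        intro f
        refine bdd_integrable ((@SimpleFunc.measurable α ℝ k _ f).mono hk le_rfl) ?_
        obtain ⟨C, hC⟩ := (@SimpleFunc.exists_forall_norm_le α ℝ k _ f)
        exact ⟨C, hC⟩
      rw [@SimpleFunc.coe_add α ℝ k]
      exact (hf.add hg).congr (condExp_add (hi f) (hi g) m).symm

end CubicAux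

namespace CubicAux

open Filter Topology

section cyl

variable {Ω ι κ : Type*} [mΩ : MeasurableSpace Ω]

theorem cyl_eq (T : Set ι) :
    cylinderAlg (Ω := Ω) ι T = ⨆ v ∈ T, MeasurableSpace.comap (fun ω : ι → Ω => ω v) mΩ := by
  unfold cylinderAlg MeasurableSpace.pi
  rw [MeasurableSpace.comap_iSup, iSup_subtype']
  simp only [MeasurableSpace.comap_comp]
  rfl

theorem cyl_mono {S T : Set ι} (h : S ⊆ T) :
    cylinderAlg (Ω := Ω) ι S ≤ cylinderAlg (Ω := Ω) ι T := by
  rw [cyl_eq, cyl_eq]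
  exact biSup_mono h

theorem cyl_univ : cylinderAlg (Ω := Ω) ι univ = MeasurableSpace.pi := by
  rw [cyl_eq]; simp [MeasurableSpace.pi]

theorem cyl_le (T : Set ι) : cylinderAlg (Ω := Ω) ι T ≤ MeasurableSpace.pi := by
  rw [← cyl_univ]; exact cyl_mono (subset_univ _)

theorem cyl_union (S T : Set ι) :
    cylinderAlg (Ω := Ω) ι (S ∪ T) = cylinderAlg (Ω := Ω) ι S ⊔ cylinderAlg (Ω := Ω) ι T := by
  rw [cyl_eq, cyl_eq, cyl_eq, iSup_union]

theorem cyl_image (φ : ι → κ) (T : Set ι) :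
    cylinderAlg (Ω := Ω) κ (φ '' T) =
      MeasurableSpace.comap (fun ω : κ → Ω => ω ∘ φ) (cylinderAlg (Ω := Ω) ι T) := by
  rw [cyl_eq, cyl_eq, iSup_image]
  simp only [MeasurableSpace.comap_iSup, MeasurableSpace.comap_comp]
  rfl

theorem cyl_dep {T : Set ι} {b : (ι → Ω) → ℝ} (hb : Measurable[cylinderAlg ι T] b)
    {x y : ι → Ω} (h : ∀ v ∈ T, x v = y v) : b x = b y := by
  obtain ⟨t, _, ht⟩ := hb (measurableSet_singleton (b x))
  have hx : x ∈ b ⁻¹' {b x} := rfl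
  rw [← ht] at hx
  have hy : y ∈ b ⁻¹' {b x} := by
    rw [← ht]
    have : T.domRestrict y = T.domRestrict x := by
      ext v; exact (h v.1 v.2).symm
    change T.domRestrict y ∈ t
    rw [this]; exact hx
  exact hy.symm

theorem measurable_compMap (φ : ι → κ) : Measurable (fun ω : κ → Ω => ω ∘ φ) :=
  measurable_pi_lambda _ fun v => measurable_pi_apply (φ v)

/-- `E(h|T2) = E(h|T3)` for all bounded `T1`-measurable `h`. -/
def Comm (ν : Measure (ι → Ω)) (T1 T2 T3 : Set ι) : Prop :=
  ∀ h : (ι → Ω) → ℝ, Measurable[cylinderAlg ι T1] h → (∃ C, ∀ x, |h x| ≤ C) →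
    ν[h|cylinderAlg ι T2] =ᵐ[ν] ν[h|cylinderAlg ι T3]

theorem comm_of_bot {ν : Measure (ι → Ω)} [IsProbabilityMeasure ν] {T1 T2 : Set ι}
    (h : BotRel ν T1 T2) : Comm ν T1 T2 (T1 ∩ T2) := fun _ hf hb =>
  comm_of_condIndep (cyl_le _) (cyl_le _) (cyl_mono inter_subset_right) h.1 h.2 hf hb

/-- clipping -/
noncomputable def clip {α : Type*} (C : ℝ) (f : α → ℝ) : α → ℝ := fun x => max (-C) (min C (f x))

theorem clip_bdd {α : Type*} {C : ℝ} (hC : 0 ≤ C) (f : α → ℝ) (x : α) : |clip C f x| ≤ C := by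
  unfold clip
  rw [abs_le]
  exact ⟨le_max_left _ _, max_le (by linarith) (min_le_left _ _)⟩

theorem clip_eq {α : Type*} {C : ℝ} {f : α → ℝ} {x : α} (h : |f x| ≤ C) : clip C f x = f x := by
  unfold clip
  rw [abs_le] at h
  rw [min_eq_right h.2, max_eq_right h.1]

theorem clip_meas {α : Type*} {m : MeasurableSpace α} {C : ℝ} {f : α → ℝ} (h : Measurable f) :
    Measurable (clip C f) :=
  measurable_const.max (measurable_const.min h)

theorem comm_image {ν : Measure (κ → Ω)} [IsProbabilityMeasure ν] (φ : ι → κ) {T1 T2 T3 : Set ι}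
    (h : Comm (ν.map (fun ω => ω ∘ φ)) T1 T2 T3) : Comm ν (φ '' T1) (φ '' T2) (φ '' T3) := by
  intro f hf hb
  rw [cyl_image] at hf
  obtain ⟨g, hg, rfl⟩ := @Measurable.exists_eq_measurable_comp _ _ _ (cylinderAlg ι T1)
    _ _ _ _ _ hf
  obtain ⟨C, hC⟩ := hb
  by_cases hC0 : 0 ≤ C
  swap
  · have : IsEmpty (κ → Ω) := ⟨fun x => hC0 ((abs_nonneg _).trans (hC x))⟩
    exact ae_of_all _ fun x => isEmptyElim x
  have e : g ∘ (fun ω : κ → Ω => ω ∘ φ) = clip C g ∘ (fun ω : κ → Ω => ω ∘ φ) := by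
    ext x
    exact (clip_eq (hC x)).symm
  have hcm : Measurable[cylinderAlg ι T1] (clip C g) := clip_meas hg
  have hcb : ∃ C', ∀ x, |clip C g x| ≤ C' := ⟨C, clip_bdd hC0 g⟩
  rw [e, cyl_image, cyl_image]
  have hφ := measurable_compMap (Ω := Ω) φ
  have k := h _ hcm hcb
  have k2 := ae_of_ae_map hφ.aemeasurable k
  refine (condExp_map_comap hφ (cyl_le _) (hcm.mono (cyl_le _) le_rfl) hcb).symm.trans ?_
  refine EventuallyEq.trans ?_
    (condExp_map_comap hφ (cyl_le _) (hcm.mono (cyl_le _) le_rfl) hcb)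
  exact k2

end cyl

section cube

variable {Ω : Type*} [mΩ : MeasurableSpace Ω] {lam : Measure Ω} [IsProbabilityMeasure lam]
    {μ : (n : ℕ) → Measure ((Fin n → Bool) → Ω)}

/-- lower faces -/
def lowF {d : ℕ} (i : Fin d) : Set (Fin d → Bool) := {v | v i = false}

/-- upper faces -/
def upF {d : ℕ} (i : Fin d) : Set (Fin d → Bool) := {v | v i = true}

/-- iterated lower faces -/
def itF (d j : ℕ) : Set (Fin d → Bool) := {v | ∀ i : Fin d, i.1 < j → v i = false}

theorem isProb (hμ : IsCubicCoupling lam μ) (n : ℕ) : IsProbabilityMeasure (μ n) := by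
  have h := hμ.coupling n (fun _ => false)
  constructor
  have h2 := congrArg (fun m => m univ) h
  simp only [measure_univ] at h2
  rwa [Measure.map_apply (measurable_pi_apply _) MeasurableSet.univ, preimage_univ] at h2

theorem face_comm (hμ : IsCubicCoupling lam μ) {d : ℕ} {i j : Fin d} (hij : i ≠ j) :
    Comm (μ d) (lowF i) (lowF j) (lowF i ∩ lowF j) := by
  obtain _ | n := d
  · exact i.elim0
  have := isProb hμ (n + 1)
  have hn : (0 : Fin (n + 1)) ≠ Fin.last n := by
    intro h
    have h1 : (0 : ℕ) = n := congrArg Fin.val h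
    apply hij
    ext
    omega
  obtain ⟨σ, hσ0, hσ1⟩ : ∃ σ : Equiv.Perm (Fin (n + 1)), σ 0 = i ∧ σ (Fin.last n) = j := by
    refine ⟨Equiv.swap (Equiv.swap 0 i (Fin.last n)) j * Equiv.swap 0 i, ?_, ?_⟩
    · rw [Equiv.Perm.mul_apply, Equiv.swap_apply_left, Equiv.swap_apply_of_ne_of_ne _ hij]
      intro h
      have : Equiv.swap 0 i i = Equiv.swap 0 i (Equiv.swap 0 i (Fin.last n)) := congrArg _ h
      rw [Equiv.swap_apply_right, Equiv.swap_apply_self] at this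
      exact hn this
    · rw [Equiv.Perm.mul_apply, Equiv.swap_apply_left]
  let φ : (Fin (n + 1) → Bool) → (Fin (n + 1) → Bool) := fun v => v ∘ σ.symm
  have hφc : IsCubeMorphism φ := fun k => Or.inr ⟨σ.symm k, Or.inl fun v => rfl⟩
  have hφi : Function.Injective φ := fun v w h => by
    ext k
    have := congrFun h (σ k)
    simpa [φ] using this
  have himg : ∀ S : Set (Fin (n + 1) → Bool), φ '' S = {v | v ∘ σ ∈ S} := by
    intro S
    ext v
    constructor
    · rintro ⟨w, hw, rfl⟩
      have : φ w ∘ σ = w := by ext k; simp [φ]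
      simpa [this] using hw
    · intro hv
      exact ⟨v ∘ σ, hv, by ext k; simp [φ]⟩
  have key := comm_of_bot (hμ.condIndep n)
  rw [← hμ.consistency φ hφc hφi] at key
  have key2 := comm_image φ key
  rw [himg, himg, himg] at key2
  have e1 : {v : Fin (n + 1) → Bool | v ∘ σ ∈ {v : Fin (n + 1) → Bool | v 0 = false}} = lowF i := by
    ext v; simp [lowF, hσ0]
  have e2 : {v : Fin (n + 1) → Bool | v ∘ σ ∈ {v : Fin (n + 1) → Bool | v (Fin.last n) = false}}
      = lowF j := by
    ext v; simp [lowF, hσ1]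
  have e3 : {v : Fin (n + 1) → Bool | v ∘ σ ∈ {v : Fin (n + 1) → Bool | v 0 = false} ∩
      {v : Fin (n + 1) → Bool | v (Fin.last n) = false}} = lowF i ∩ lowF j := by
    ext v; simp [lowF, hσ0, hσ1]
  rwa [e1, e2, e3] at key2

theorem it_comm (hμ : IsCubicCoupling lam μ) : ∀ (d : ℕ) (j : Fin d),
    Comm (μ d) (itF d j.1) (lowF j) (itF d (j.1 + 1)) := by
  intro d
  induction d with
  | zero => exact fun j => j.elim0
  | succ d ih =>
    intro j
    have := isProb hμ (d + 1)
    have := isProb hμ d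
    obtain rfl | ⟨j', rfl⟩ := Fin.eq_zero_or_eq_succ j
    · have e : itF (d + 1) ((0 : Fin (d + 1)).1 + 1) = lowF 0 := by
        ext v
        simp only [itF, lowF, mem_ofPred_eq]
        constructor
        · intro h; exact h 0 (by simp)
        · intro h i hi
          have : i = 0 := by ext; simpa using hi
          rwa [this]
      rw [e]
      exact fun h _ _ => EventuallyEq.rfl
    let φ : (Fin d → Bool) → (Fin (d + 1) → Bool) := fun v => Fin.cons false v
    have hφc : IsCubeMorphism φ := by
      intro k
      obtain rfl | ⟨k', rfl⟩ := Fin.eq_zero_or_eq_succ k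
      · exact Or.inl ⟨false, fun v => rfl⟩
      · exact Or.inr ⟨k', Or.inl fun v => by simp [φ]⟩
    have hφi : Function.Injective φ := fun v w h => by
      ext k
      have := congrFun h k.succ
      simpa [φ] using this
    have himg : ∀ S : Set (Fin d → Bool), φ '' S = {v | v 0 = false ∧ (fun i => v i.succ) ∈ S} := by
      intro S
      ext v
      constructor
      · rintro ⟨w, hw, rfl⟩
        exact ⟨rfl, by simpa [φ] using hw⟩
      · rintro ⟨h0, hv⟩
        refine ⟨fun i => v i.succ, hv, ?_⟩
        change Fin.cons false (Fin.tail v) = v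
        rw [← h0]
        exact Fin.cons_self_tail v
    have key := ih j'
    rw [← hμ.consistency φ hφc hφi] at key
    have key2 := comm_image φ key
    have eit : ∀ k, φ '' (itF d k) = itF (d + 1) (k + 1) := by
      intro k
      rw [himg]
      ext v
      simp only [itF, mem_ofPred_eq, Fin.forall_fin_succ]
      simp
    have elow : φ '' (lowF j') = lowF 0 ∩ lowF j'.succ := by
      rw [himg]
      ext v
      simp [lowF]
    rw [eit, eit, elow] at key2
    intro h hh hb
    have h0 : Measurable[cylinderAlg _ (lowF (0 : Fin (d + 1)))] h := by
      refine hh.mono (cyl_mono ?_) le_rfl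
      intro v hv
      exact hv 0 (by simp)
    refine (face_comm hμ (Fin.succ_ne_zero j').symm h h0 hb).trans ?_
    exact key2 h hh hb

/-- the conditional expectation of an upper-face function onto the lower face is again
measurable with respect to the upper face. -/
theorem reflect (hμ : IsCubicCoupling lam μ) {d : ℕ} (j : Fin d)
    {a : ((Fin d → Bool) → Ω) → ℝ} (ha : Measurable[cylinderAlg _ (upF j)] a)
    (hab : ∃ C, ∀ x, |a x| ≤ C) :
    AEStronglyMeasurable[cylinderAlg _ (upF j)] ((μ d)[a|cylinderAlg _ (lowF j)]) (μ d) := by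
  classical
  have := isProb hμ (d + 1)
  have := isProb hμ d
  obtain ⟨C', hC'⟩ := hab
  set C := |C'| with hCdef
  have hC0 : 0 ≤ C := abs_nonneg _
  have hC : ∀ x, |a x| ≤ C := fun x => (hC' x).trans (le_abs_self _)
  have ha0 : Measurable a := ha.mono (cyl_le _) le_rfl
  -- the cube morphisms
  let ρ : (Fin d → Bool) → (Fin d → Bool) := fun v => Function.update v j (!(v j))
  let p : (Fin d → Bool) → (Fin (d + 1) → Bool) := fun v => Fin.snoc v false
  let q : (Fin d → Bool) → (Fin (d + 1) → Bool) := fun v =>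
    Fin.snoc (Function.update v j false) (v j)
  let r : (Fin d → Bool) → (Fin (d + 1) → Bool) := fun v => Fin.snoc v (!(v j))
  have hρρ : ∀ v, ρ (ρ v) = v := by
    intro v; simp [ρ]
  have hρc : IsCubeMorphism ρ := by
    intro k
    by_cases hk : k = j
    · subst hk
      exact Or.inr ⟨k, Or.inr fun v => by simp [ρ]⟩
    · exact Or.inr ⟨k, Or.inl fun v => by simp [ρ, hk]⟩
  have hρi : Function.Injective ρ := Function.LeftInverse.injective hρρ
  have hpc : IsCubeMorphism p := by
    intro k
    refine Fin.lastCases ?_ (fun k => ?_) k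
    · exact Or.inl ⟨false, fun v => by simp [p]⟩
    · exact Or.inr ⟨k, Or.inl fun v => by simp [p]⟩
  have hpi : Function.Injective p := fun v w h => by
    ext k
    have := congrFun h k.castSucc
    simpa [p] using this
  have hrc : IsCubeMorphism r := by
    intro k
    refine Fin.lastCases ?_ (fun k => ?_) k
    · exact Or.inr ⟨j, Or.inr fun v => by simp [r]⟩
    · exact Or.inr ⟨k, Or.inl fun v => by simp [r]⟩
  have hri : Function.Injective r := fun v w h => by
    ext k
    have := congrFun h k.castSucc
    simpa [r] using this
  have hqc : IsCubeMorphism q := by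
    intro k
    refine Fin.lastCases ?_ (fun k => ?_) k
    · exact Or.inr ⟨j, Or.inl fun v => by simp only [q, Fin.snoc_last]⟩
    · by_cases hk : k = j
      · subst hk
        exact Or.inl ⟨false, fun v => by simp [q]⟩
      · exact Or.inr ⟨k, Or.inl fun v => by simp [q, hk]⟩
  have hqi : Function.Injective q := fun v w h => by
    ext k
    by_cases hk : k = j
    · subst hk
      have := congrFun h (Fin.last d)
      simp only [q, Fin.snoc_last] at this
      rw [this]
    · have := congrFun h k.castSucc
      simpa [q, hk] using this
  have mp := hμ.consistency p hpc hpi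
  have mq := hμ.consistency q hqc hqi
  have mr := hμ.consistency r hrc hri
  have mρ := hμ.consistency ρ hρc hρi
  -- measurability of the precomposition maps
  have sp := measurable_compMap (Ω := Ω) p
  have sq := measurable_compMap (Ω := Ω) q
  have sr := measurable_compMap (Ω := Ω) r
  have sρ := measurable_compMap (Ω := Ω) ρ
  have pq : ∀ v ∈ lowF j, p v = q v := by
    intro v hv
    have hv' : v j = false := hv
    have : Function.update v j false = v := by rw [← hv', Function.update_eq_self]
    simp only [p, q, this, hv']
  have pr : ∀ v ∈ upF j, p v = r v := by
    intro v hv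
    have hv' : v j = true := hv
    simp [p, r, hv']
  have qr : ∀ v ∈ lowF j, q (ρ v) = r v := by
    intro v hv
    have hv' : v j = false := hv
    have : Function.update v j false = v := by rw [← hv', Function.update_eq_self]
    simp [q, r, ρ, hv']
  -- the bounded version of the conditional expectation
  set b := clip C ((μ d)[a|cylinderAlg (Ω := Ω) _ (lowF j)]) with hb
  have hbm : Measurable[cylinderAlg (Ω := Ω) _ (lowF j)] b := clip_meas stronglyMeasurable_condExp.measurable
  have hbm0 : Measurable b := hbm.mono (cyl_le _) le_rfl
  have hbb : ∀ x, |b x| ≤ C := clip_bdd hC0 _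
  have hbe : (μ d)[a|cylinderAlg (Ω := Ω) _ (lowF j)] =ᵐ[μ d] b := by
    have := ae_bdd_abs_condExp_of_ae_bdd_abs (m := cylinderAlg (Ω := Ω) _ (lowF j)) (μ := μ d) (ae_of_all _ hC)
    filter_upwards [this] with x hx
    exact (clip_eq hx).symm
  have iprod : ∀ {n : ℕ} (f g : ((Fin n → Bool) → Ω) → ℝ), Measurable f → Measurable g →
      (∀ x, |f x| ≤ C) → (∀ x, |g x| ≤ C) → Integrable (f * g) (μ n) := by
    intro n f g hf hg hfC hgC
    have := isProb hμ n
    refine bdd_integrable (hf.mul hg) ⟨C * C, fun x => ?_⟩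
    rw [Pi.mul_apply, abs_mul]
    exact mul_le_mul (hfC x) (hgC x) (abs_nonneg _) hC0
  have change_var : ∀ {n : ℕ} (φ : (Fin d → Bool) → (Fin n → Bool))
      (_ : (μ n).map (fun ω => ω ∘ φ) = μ d) (f : ((Fin d → Bool) → Ω) → ℝ), Measurable f →
      ∫ ω, f (ω ∘ φ) ∂(μ n) = ∫ x, f x ∂(μ d) := by
    intro n φ hφ f hf
    rw [← hφ, integral_map (measurable_compMap φ).aemeasurable]
    exact hf.aestronglyMeasurable
  -- first integral identity
  have id1 : ∫ x, a x * b x ∂(μ d) = ∫ x, b x * b x ∂(μ d) := by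
    have h1 : (μ d)[a * b|cylinderAlg (Ω := Ω) _ (lowF j)] =ᵐ[μ d] (μ d)[a|cylinderAlg (Ω := Ω) _ (lowF j)] * b :=
      condExp_mul_of_aestronglyMeasurable_right hbm.stronglyMeasurable.aestronglyMeasurable
        (iprod a b ha0 hbm0 hC hbb) (bdd_integrable ha0 ⟨C, hC⟩)
    have h2 : ∫ x, (a * b) x ∂(μ d) = ∫ x, (b * b) x ∂(μ d) := by
      rw [← integral_condExp (cyl_le (lowF j))]
      refine integral_congr_ae (h1.trans ?_)
      filter_upwards [hbe] with x hx
      rw [Pi.mul_apply, Pi.mul_apply, hx]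
    exact h2
  -- second integral identity
  have id2 : ∫ x, a x * b x ∂(μ d) = ∫ x, b x * b (x ∘ ρ) ∂(μ d) := by
    let A : ((Fin (d + 1) → Bool) → Ω) → ℝ := fun ω => a (ω ∘ p)
    let B : ((Fin (d + 1) → Bool) → Ω) → ℝ := fun ω => b ((ω ∘ q) ∘ ρ)
    have hA : Measurable[cylinderAlg _ (lowF (Fin.last d))] A := by
      have h1 : Measurable[cylinderAlg _ (p '' univ)] A := by
        rw [cyl_image, cyl_univ]
        exact ha0.comp (comap_measurable _)
      refine h1.mono (cyl_mono ?_) le_rfl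
      rintro _ ⟨v, _, rfl⟩
      simp [lowF, p]
    have hB : Measurable[cylinderAlg (Ω := Ω) _ (lowF j.castSucc)] B := by
      have h1 : Measurable[cylinderAlg _ (q '' univ)] B := by
        rw [cyl_image, cyl_univ]
        exact (hbm0.comp sρ).comp (comap_measurable _)
      refine h1.mono (cyl_mono ?_) le_rfl
      rintro _ ⟨v, _, rfl⟩
      simp [lowF, q]
    have hA0 : Measurable A := hA.mono (cyl_le _) le_rfl
    have hB0 : Measurable B := hB.mono (cyl_le _) le_rfl
    have hAC : ∀ x, |A x| ≤ C := fun x => hC _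
    have hBC : ∀ x, |B x| ≤ C := fun x => hbb _
    have e1 : (μ (d + 1))[A|cylinderAlg (Ω := Ω) _ (lowF j.castSucc)] =ᵐ[μ (d + 1)] fun ω => b (ω ∘ p) := by
      have c1 := face_comm hμ (Fin.castSucc_lt_last j).ne' A hA ⟨C, hAC⟩
      refine c1.trans ?_
      have himg : lowF (Fin.last d) ∩ lowF j.castSucc = p '' (lowF j) := by
        ext v
        constructor
        · rintro ⟨h1, h2⟩
          refine ⟨Fin.init v, h2, ?_⟩
          have h1' : v (Fin.last d) = false := h1
          change Fin.snoc (Fin.init v) false = v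
          rw [← h1', Fin.snoc_init_self]
        · rintro ⟨w, hw, rfl⟩
          have hw' : w j = false := hw
          simp [lowF, p, hw']
      rw [himg, cyl_image]
      have c2 := condExp_map_comap (ν := μ (d + 1)) sp (cyl_le (lowF j)) ha0 ⟨C, hC⟩
      refine c2.symm.trans ?_
      rw [mp]
      rw [← mp] at hbe
      have := ae_of_ae_map sp.aemeasurable hbe
      rw [mp] at this
      exact this
    have h1 : (μ (d + 1))[A * B|cylinderAlg (Ω := Ω) _ (lowF j.castSucc)] =ᵐ[μ (d + 1)] (μ (d + 1))[A|cylinderAlg (Ω := Ω) _ (lowF j.castSucc)] * B :=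
      condExp_mul_of_aestronglyMeasurable_right hB.stronglyMeasurable.aestronglyMeasurable
        (iprod A B hA0 hB0 hAC hBC) (bdd_integrable hA0 ⟨C, hAC⟩)
    have h2 : ∫ ω, A ω * B ω ∂(μ (d + 1)) = ∫ ω, b (ω ∘ p) * B ω ∂(μ (d + 1)) := by
      have h3 : ∫ ω, (A * B) ω ∂(μ (d + 1)) = ∫ ω, b (ω ∘ p) * B ω ∂(μ (d + 1)) := by
        rw [← integral_condExp (cyl_le (lowF j.castSucc))]
        refine integral_congr_ae (h1.trans ?_)
        filter_upwards [e1] with x hx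
        rw [Pi.mul_apply, hx]
      exact h3
    have h4 : ∀ ω : (Fin (d + 1) → Bool) → Ω, b (ω ∘ p) * B ω =
        (fun x => b x * b (x ∘ ρ)) (ω ∘ q) := by
      intro ω
      have : b (ω ∘ p) = b (ω ∘ q) := cyl_dep hbm fun v hv => by
        simp only [Function.comp_apply, pq v hv]
      simp only [this, B]
    have h5 : ∀ ω : (Fin (d + 1) → Bool) → Ω, A ω * B ω = (fun x => a x * b x) (ω ∘ r) := by
      intro ω
      have e : a (ω ∘ p) = a (ω ∘ r) := cyl_dep ha fun v hv => by
        simp only [Function.comp_apply, pr v hv]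
      have e' : b ((ω ∘ q) ∘ ρ) = b (ω ∘ r) := cyl_dep hbm fun v hv => by
        simp only [Function.comp_apply, qr v hv]
      simp only [A, B, e, e']
    simp only [h4, h5] at h2
    rw [change_var r mr (fun x => a x * b x) (ha0.mul hbm0),
      change_var q mq (fun x => b x * b (x ∘ ρ)) (hbm0.mul (hbm0.comp sρ))] at h2
    exact h2
  have id3 : ∫ x, b (x ∘ ρ) * b (x ∘ ρ) ∂(μ d) = ∫ x, b x * b x ∂(μ d) :=
    change_var ρ mρ (fun x => b x * b x) (hbm0.mul hbm0)
  have hbR0 : Measurable (fun x : (Fin d → Bool) → Ω => b (x ∘ ρ)) := hbm0.comp sρ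
  have hzero : ∫ x, (b x - b (x ∘ ρ)) ^ 2 ∂(μ d) = 0 := by
    have e : ∀ x : (Fin d → Bool) → Ω, (b x - b (x ∘ ρ)) ^ 2 =
        (b x * b x - 2 * (b x * b (x ∘ ρ))) + b (x ∘ ρ) * b (x ∘ ρ) := fun x => by ring
    simp only [e]
    have i1 : Integrable (fun x => b x * b x) (μ d) := iprod b b hbm0 hbm0 hbb hbb
    have i2 : Integrable (fun x => b x * b (x ∘ ρ)) (μ d) :=
      iprod b (fun x => b (x ∘ ρ)) hbm0 hbR0 hbb (fun x => hbb _)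
    have i3 : Integrable (fun x => b (x ∘ ρ) * b (x ∘ ρ)) (μ d) :=
      iprod (fun x => b (x ∘ ρ)) (fun x => b (x ∘ ρ)) hbR0 hbR0
      (fun x => hbb _) (fun x => hbb _)
    have i12 : Integrable (fun x => b x * b x - 2 * (b x * b (x ∘ ρ))) (μ d) :=
      i1.sub (i2.const_mul 2)
    rw [integral_add i12 i3, integral_sub i1 (i2.const_mul 2),
      integral_const_mul, id3, ← id2, id1]
    ring
  have hint : Integrable (fun x : (Fin d → Bool) → Ω => (b x - b (x ∘ ρ)) ^ 2) (μ d) := by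
    refine bdd_integrable ((hbm0.sub hbR0).pow_const 2) ⟨(2 * C) ^ 2, fun x => ?_⟩
    rw [abs_pow]
    refine pow_le_pow_left₀ (abs_nonneg _) ?_ 2
    have h1 := abs_sub (b x) (b (x ∘ ρ))
    linarith [hbb x, hbb (x ∘ ρ)]
  have hae := (integral_eq_zero_iff_of_nonneg (fun x => sq_nonneg _) hint).1 hzero
  refine ⟨fun x => b (x ∘ ρ), ?_, hbe.trans ?_⟩
  · have h1 : Measurable[cylinderAlg _ (ρ '' lowF j)] (fun x : (Fin d → Bool) → Ω => b (x ∘ ρ)) := by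
      rw [cyl_image]
      exact hbm.comp (comap_measurable _)
    refine (h1.mono (cyl_mono ?_) le_rfl).stronglyMeasurable
    rintro _ ⟨v, hv, rfl⟩
    have hv' : v j = false := hv
    simp [upF, ρ, hv']
  · filter_upwards [hae] with x hx
    have : (b x - b (x ∘ ρ)) ^ 2 = 0 := hx
    exact sub_eq_zero.1 (pow_eq_zero_iff (two_ne_zero)|>.1 this)

/-- The conditional expectation onto a lower face preserves measurability with respect to the
punctured cube. -/
theorem preserve (hμ : IsCubicCoupling lam μ) {d : ℕ} (j : Fin d)
    {h : ((Fin d → Bool) → Ω) → ℝ}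
    (hh : Measurable[cylinderAlg _ ({fun _ => false}ᶜ : Set (Fin d → Bool))] h)
    (hb : ∃ C, ∀ x, |h x| ≤ C) :
    AEStronglyMeasurable[cylinderAlg _ ({fun _ => false}ᶜ : Set (Fin d → Bool))]
      ((μ d)[h|cylinderAlg _ (lowF j)]) (μ d) := by
  have := isProb hμ d
  set K : Set (Fin d → Bool) := {fun _ => false}ᶜ with hK
  set L : Set (Fin d → Bool) := lowF j ∩ K with hL
  have hKU : K = L ∪ upF j := by
    ext v
    constructor
    · intro hv
      by_cases hj : v j = false
      · exact Or.inl ⟨hj, hv⟩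
      · exact Or.inr (by simpa [upF] using hj)
    · rintro (⟨_, hv⟩ | hv)
      · exact hv
      · intro h0
        have h0' : v = fun _ => false := h0
        have hv' : v j = true := hv
        rw [h0'] at hv'
        simp at hv'
  have hLK : L ⊆ K := inter_subset_right
  have hUK : upF j ⊆ K := by rw [hKU]; exact subset_union_right
  let S : Set (Set ((Fin d → Bool) → Ω)) :=
    {u | ∃ s t, MeasurableSet[cylinderAlg _ L] s ∧ MeasurableSet[cylinderAlg _ (upF j)] t ∧ u = s ∩ t}
  refine condExp_aem_of_pi (S := S) (cyl_le _) (cyl_le _) ?_ ?_ ?_ hh hb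
  · apply le_antisymm
    · rw [hKU, cyl_union]
      refine sup_le ?_ ?_
      · intro s hs
        exact MeasurableSpace.measurableSet_generateFrom
          ⟨s, univ, hs, @MeasurableSet.univ _ (cylinderAlg _ (upF j)), (inter_univ s).symm⟩
      · intro s hs
        exact MeasurableSpace.measurableSet_generateFrom
          ⟨univ, s, @MeasurableSet.univ _ (cylinderAlg _ L), hs, (univ_inter s).symm⟩
    · refine MeasurableSpace.generateFrom_le ?_
      rintro _ ⟨s, t, hs, ht, rfl⟩
      exact @MeasurableSet.inter _ (cylinderAlg _ K) _ _ (cyl_mono hLK s hs) (cyl_mono hUK t ht)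
  · rintro _ ⟨s, t, hs, ht, rfl⟩ _ ⟨s', t', hs', ht', rfl⟩ _
    exact ⟨s ∩ s', t ∩ t', @MeasurableSet.inter _ (cylinderAlg _ L) _ _ hs hs',
      @MeasurableSet.inter _ (cylinderAlg _ (upF j)) _ _ ht ht', inter_inter_inter_comm s t s' t'⟩
  · rintro _ ⟨s, t, hs, ht, rfl⟩
    have e : ((s ∩ t).indicator fun _ => (1:ℝ)) =
        (s.indicator fun _ => (1:ℝ)) * (t.indicator fun _ => (1:ℝ)) := by
      ext x
      by_cases h1 : x ∈ s <;> by_cases h2 : x ∈ t <;> simp [h1, h2]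
    have ms : ∀ T : Set (Fin d → Bool), L ⊆ T →
        StronglyMeasurable[cylinderAlg _ T] (s.indicator fun _ => (1:ℝ)) := fun T hT =>
      stronglyMeasurable_const.indicator (cyl_mono hT s hs)
    have mt : Measurable[cylinderAlg _ (upF j)] (t.indicator fun _ => (1:ℝ)) :=
      measurable_const.indicator ht
    have hs0 := cyl_le _ s hs
    have ht0 := cyl_le _ t ht
    have hpull : (μ d)[(s.indicator fun _ => (1:ℝ)) * (t.indicator fun _ => (1:ℝ))|
        cylinderAlg _ (lowF j)] =ᵐ[μ d] (s.indicator fun _ => (1:ℝ)) *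
        (μ d)[(t.indicator fun _ => (1:ℝ))|cylinderAlg _ (lowF j)] := by
      refine condExp_mul_of_aestronglyMeasurable_left
        (ms _ inter_subset_left).aestronglyMeasurable ?_ ((integrable_const (1:ℝ)).indicator ht0)
      rw [← e]
      exact (integrable_const (1:ℝ)).indicator (hs0.inter ht0)
    rw [e]
    refine AEStronglyMeasurable.congr ?_ hpull.symm
    refine (ms K hLK).aestronglyMeasurable.mul ?_
    have := reflect hμ j mt ⟨1, fun x => by by_cases h : x ∈ t <;> simp [h]⟩
    exact this.mono (cyl_mono hUK)

theorem preserve_it (hμ : IsCubicCoupling lam μ) {d : ℕ}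
    {h : ((Fin d → Bool) → Ω) → ℝ}
    (hh : Measurable[cylinderAlg _ ({fun _ => false}ᶜ : Set (Fin d → Bool))] h)
    (hb : ∃ C, ∀ x, |h x| ≤ C) : ∀ j, j ≤ d →
    AEStronglyMeasurable[cylinderAlg _ ({fun _ => false}ᶜ : Set (Fin d → Bool))]
      ((μ d)[h|cylinderAlg _ (itF d j)]) (μ d) := by
  have := isProb hμ d
  obtain ⟨C', hC'⟩ := hb
  set C := |C'| with hCdef
  have hC0 : 0 ≤ C := abs_nonneg _
  have hC : ∀ x, |h x| ≤ C := fun x => (hC' x).trans (le_abs_self _)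
  have hh0 : Measurable h := hh.mono (cyl_le _) le_rfl
  intro j
  induction j with
  | zero =>
    intro _
    have e : itF d 0 = univ := by ext v; simp [itF]
    rw [e, cyl_univ, condExp_of_stronglyMeasurable le_rfl hh0.stronglyMeasurable
      (bdd_integrable hh0 ⟨C, hC⟩)]
    exact hh.stronglyMeasurable.aestronglyMeasurable
  | succ j ih =>
    intro hj
    obtain ⟨w, hw, huw⟩ := ih (by omega)
    set u := (μ d)[h|cylinderAlg _ (itF d j)] with hu
    have hub : ∀ᵐ x ∂(μ d), |u x| ≤ C :=
      ae_bdd_abs_condExp_of_ae_bdd_abs (m := cylinderAlg _ (itF d j)) (μ := μ d) (ae_of_all _ hC)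
    have hum : Measurable[cylinderAlg _ (itF d j)] (clip C u) :=
      clip_meas stronglyMeasurable_condExp.measurable
    have hwm : Measurable[cylinderAlg _ ({fun _ => false}ᶜ : Set (Fin d → Bool))] (clip C w) :=
      clip_meas hw.measurable
    have e1 : clip C u =ᵐ[μ d] u := hub.mono fun x hx => clip_eq hx
    have e2 : clip C w =ᵐ[μ d] clip C u := huw.mono fun x hx => by simp only [clip, hx]
    have p1 := preserve hμ ⟨j, by omega⟩ hwm ⟨C, clip_bdd hC0 w⟩
    refine p1.congr ?_
    refine (condExp_congr_ae e2).trans ?_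
    refine (it_comm hμ d ⟨j, by omega⟩ _ hum ⟨C, clip_bdd hC0 u⟩).trans ?_
    refine (condExp_congr_ae e1).trans ?_
    refine condExp_condExp_of_le (cyl_mono ?_) (cyl_le _)
    intro v hv i hi
    exact hv i (by simp at hi ⊢; omega)

end cube

end CubicAux

/-- **Key conditional-independence property of cubic couplings** (Lemma 3.19).
For every cubic coupling `(μ^⟦n⟧)` and every `d ≥ 1`, letting `K_d = {0,1}^d ∖ {0^d}`,
the σ-algebras `𝒜^S_{{0^d}}` and `𝒜^S_{K_d}` are conditionally independent relative to
their meet in `μ^⟦d⟧`. -/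
theorem corner_vertex_condIndep
    {Ω : Type*} [mΩ : MeasurableSpace Ω] (lam : Measure Ω) [IsProbabilityMeasure lam]
    (μ : (n : ℕ) → Measure ((Fin n → Bool) → Ω)) (hμ : IsCubicCoupling lam μ)
    (d : ℕ) (hd : 1 ≤ d) :
    CondIndepRel (μ d)
      (cylinderAlg (Fin d → Bool) ({fun _ => false} : Set (Fin d → Bool)))
      (cylinderAlg (Fin d → Bool) ({fun _ => false}ᶜ : Set (Fin d → Bool)))
      (meetAlg (μ d)
        (cylinderAlg (Fin d → Bool) ({fun _ => false} : Set (Fin d → Bool)))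
        (cylinderAlg (Fin d → Bool) ({fun _ => false}ᶜ : Set (Fin d → Bool)))) := by
  have := CubicAux.isProb hμ d
  refine CubicAux.condIndep_of_aem (CubicAux.cyl_le _) (CubicAux.cyl_le _) ?_
  intro h hh hb
  have key := CubicAux.preserve_it hμ hh hb d le_rfl
  have e : CubicAux.itF d d = {fun _ => false} := by
    ext v
    simp only [CubicAux.itF, mem_ofPred_eq, mem_singleton_iff]
    constructor
    · intro hv
      ext i
      rw [hv i i.2]
    · intro hv i _
      rw [hv]
  rwa [e] at key
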